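/- Let A be a G4-associative algebra (As(x,y,z) = As(z,y,x) for all x,y,z) and let B be an associative K-algebra satisfying (x·y)·z = (z·y)·x for all x,y,z. Then the tensor product algebra A⊗B with multiplication (a⊗b)·(a'⊗b') = (a·a')⊗(b·b') is a G4-associative algebra: As(u,v,w) = As(w,v,u) for all u,v,w in A⊗B. -/

import Mathlib

open TensorProduct

/-- The associator of a bilinear multiplication. -/
def As {K : Type*} [Field K] {A : Type*} [AddCommGroup A] [Module K A]
    (μ : A →ₗ[K] A →ₗ[K] A) (x y z : A) : A :=
  μ (μ x y) z - μ x (μ y z)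

section Associator

variable {K : Type*} [Field K] {A : Type*} [AddCommGroup A] [Module K A]
  (μ : A →ₗ[K] A →ₗ[K] A)

theorem As_zero_left (y z : A) : As μ 0 y z = 0 := by simp [As]

theorem As_zero_middle (x z : A) : As μ x 0 z = 0 := by simp [As]

theorem As_zero_right (x y : A) : As μ x y 0 = 0 := by simp [As]

theorem As_add_left (x x' y z : A) : As μ (x + x') y z = As μ x y z + As μ x' y z := by
  simp only [As, map_add, LinearMap.add_apply]
  abel

theorem As_add_middle (x y y' z : A) : As μ x (y + y') z = As μ x y z + As μ x y' z := by
  simp only [As, map_add, LinearMap.add_apply]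
  abel

theorem As_add_right (x y z z' : A) : As μ x y (z + z') = As μ x y z + As μ x y z' := by
  simp only [As, map_add]
  abel

end Associator

/-- If the second factor is associative, the associator of pure tensors is a pure tensor. -/
theorem As_tmul {K : Type*} [Field K]
    {A : Type*} [AddCommGroup A] [Module K A]
    {B : Type*} [AddCommGroup B] [Module K B]
    (μA : A →ₗ[K] A →ₗ[K] A) (μB : B →ₗ[K] B →ₗ[K] B)
    (hBassoc : ∀ x y z : B, μB (μB x y) z = μB x (μB y z))
    (μ : TensorProduct K A B →ₗ[K] TensorProduct K A B →ₗ[K] TensorProduct K A B)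
    (hμ : ∀ (a a' : A) (b b' : B),
      μ (a ⊗ₜ[K] b) (a' ⊗ₜ[K] b') = (μA a a') ⊗ₜ[K] (μB b b'))
    (a a' a'' : A) (b b' b'' : B) :
    As μ (a ⊗ₜ[K] b) (a' ⊗ₜ[K] b') (a'' ⊗ₜ[K] b'') =
      As μA a a' a'' ⊗ₜ[K] μB (μB b b') b'' := by
  simp only [As, hμ, TensorProduct.sub_tmul, hBassoc]

/-- The tensor product of a G₄-associative algebra with an associative algebra
satisfying `(x·y)·z = (z·y)·x` is a G₄-associative algebra. -/
theorem tensor_g4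
    {K : Type*} [Field K]
    {A : Type*} [AddCommGroup A] [Module K A]
    {B : Type*} [AddCommGroup B] [Module K B]
    (μA : A →ₗ[K] A →ₗ[K] A) (μB : B →ₗ[K] B →ₗ[K] B)
    (hA : ∀ x y z : A, As μA x y z = As μA z y x)
    (hBassoc : ∀ x y z : B, μB (μB x y) z = μB x (μB y z))
    (hBswap : ∀ x y z : B, μB (μB x y) z = μB (μB z y) x)
    (μ : TensorProduct K A B →ₗ[K] TensorProduct K A B →ₗ[K] TensorProduct K A B)
    (hμ : ∀ (a a' : A) (b b' : B),
      μ (a ⊗ₜ[K] b) (a' ⊗ₜ[K] b') = (μA a a') ⊗ₜ[K] (μB b b')) :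
    ∀ u v w : TensorProduct K A B, As μ u v w = As μ w v u := by
  intro u v w
  induction u with
  | zero => rw [As_zero_left, As_zero_right]
  | add u u' hu hu' => rw [As_add_left, As_add_right, hu, hu']
  | tmul a b =>
    induction v with
    | zero => rw [As_zero_middle, As_zero_middle]
    | add v v' hv hv' => rw [As_add_middle, As_add_middle, hv, hv']
    | tmul a' b' =>
      induction w with
      | zero => rw [As_zero_right, As_zero_left]
      | add w w' hw hw' => rw [As_add_right, As_add_left, hw, hw']
      | tmul a'' b'' =>
        rw [As_tmul μA μB hBassoc μ hμ, As_tmul μA μB hBassoc μ hμ, hA, hBswap]
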